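/- Let D ⊂ ℝ² be a bounded convex nonempty open set, and for δ > 0 let D^(δ) := {x ∈ D : dist(x, ∂D) > δ}. Let (X_ε(x))_{ε∈(0,1], x∈D} be a centered Gaussian process such that the variance G(ε) := E[X_ε(x)²] does not depend on x and satisfies G(ε)/log(1/ε) → 1 as ε → 0+, and such that for every δ > 0 there is a constant C(δ) > 0 with E[(X_ε(x) − X_η(y))²] ≤ C(δ)·(‖x−y‖ + |η−ε|)/(min(η,ε)) for all x, y ∈ D^(δ) and ε, η ∈ (0,1]. Then there exists a jointly continuous modification X̃ of the process such that for every a with 0 ≤ a ≤ 2, almost surely the Hausdorff dimension of {x ∈ D : lim_{ε→0+} X̃_ε(x)/G(ε) exists and is ≥ a} is at most 2 − a²/2, and for every a > 2 this set is almost surely empty. -/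

import Mathlib

open MeasureTheory ProbabilityTheory Filter

noncomputable section

/-- A family `(X_i)_{i ∈ I}` of real random variables is a centered Gaussian process if
every finite real linear combination has a centered (possibly degenerate) Gaussian law. -/
def IsCenteredGaussianProcess {Ω : Type*} [MeasurableSpace Ω] (P : Measure Ω)
    {I : Type*} (X : I → Ω → ℝ) : Prop :=
  ∀ (n : ℕ) (c : Fin n → ℝ) (idx : Fin n → I), ∃ v : NNReal,
    Measure.map (fun ω => ∑ j, c j * X (idx j) ω) P = gaussianReal 0 v

/-- The Euclidean plane. -/
abbrev E2 := EuclideanSpace ℝ (Fin 2)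

theorem gauss_tail {Ω : Type*} [MeasurableSpace Ω] (P : Measure Ω) [IsProbabilityMeasure P]
    (Z : Ω → ℝ) (v : NNReal) (hZ : Measure.map Z P = gaussianReal 0 v)
    (σ l : ℝ) (hσ : 0 < σ) (hl : 0 ≤ l) (hv : ∫ ω, Z ω ^ 2 ∂P ≤ σ) :
    P {ω | l ≤ Z ω} ≤ ENNReal.ofReal (Real.exp (-(l ^ 2 / (2 * σ)))) := by
  have hm : AEMeasurable Z P := by
    by_contra h
    rw [Measure.map_of_not_aemeasurable h] at hZ
    have : (gaussianReal 0 v) Set.univ = 1 := measure_univ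
    rw [← hZ] at this
    simp at this
  have hvar : ∫ ω, Z ω ^ 2 ∂P = v := by
    have h1 : ∫ x, x ^ 2 ∂(Measure.map Z P) = ∫ ω, Z ω ^ 2 ∂P :=
      integral_map hm (by fun_prop)
    rw [← h1, hZ]
    have h2 := variance_id_gaussianReal (μ := 0) (v := v)
    rw [variance_eq_integral (by fun_prop)] at h2
    simpa using h2
  rw [hvar] at hv
  have hintg : Integrable (fun ω => Real.exp (l / σ * Z ω)) P := by
    have : Integrable (fun x => Real.exp (l / σ * x)) (Measure.map Z P) := by
      rw [hZ]; exact integrable_exp_mul_gaussianReal _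
    exact (integrable_map_measure (by fun_prop) hm).1 this
  have h := measure_ge_le_exp_mul_mgf (μ := P) (X := Z) (t := l / σ) l (by positivity) hintg
  rw [mgf_gaussianReal hZ, ← Real.exp_add] at h
  have h3 : P {ω | l ≤ Z ω} = ENNReal.ofReal (P.real {ω | l ≤ Z ω}) := by simp
  rw [h3]
  apply ENNReal.ofReal_le_ofReal
  refine h.trans (Real.exp_le_exp.2 ?_)
  have : (v:ℝ) * (l / σ) ^ 2 / 2 ≤ σ * (l / σ) ^ 2 / 2 := by gcongr
  have e : σ * (l / σ) ^ 2 / 2 = l ^ 2 / (2 * σ) := by field_simp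
  have e2 : -(l / σ) * l = - (2 * (l ^ 2 / (2 * σ))) := by field_simp
  rw [e2]
  linarith

theorem gauss_one {Ω : Type*} [MeasurableSpace Ω] {P : Measure Ω}
    {D : Set E2} {X : ℝ → E2 → Ω → ℝ}
    (hgauss : IsCenteredGaussianProcess P
      (fun p : (Set.Ioc (0:ℝ) 1) × D => X p.1.1 p.2.1))
    {ε : ℝ} {x : E2} (hε : ε ∈ Set.Ioc (0:ℝ) 1) (hx : x ∈ D) :
    ∃ v : NNReal, Measure.map (fun ω => X ε x ω) P = gaussianReal 0 v := by
  obtain ⟨v, hv⟩ := hgauss 1 ![1] ![(⟨ε, hε⟩, ⟨x, hx⟩)]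
  exact ⟨v, by simpa using hv⟩

theorem gauss_two {Ω : Type*} [MeasurableSpace Ω] {P : Measure Ω}
    {D : Set E2} {X : ℝ → E2 → Ω → ℝ}
    (hgauss : IsCenteredGaussianProcess P
      (fun p : (Set.Ioc (0:ℝ) 1) × D => X p.1.1 p.2.1))
    {ε η : ℝ} {x y : E2} (hε : ε ∈ Set.Ioc (0:ℝ) 1) (hx : x ∈ D)
    (hη : η ∈ Set.Ioc (0:ℝ) 1) (hy : y ∈ D) :
    ∃ v : NNReal, Measure.map (fun ω => X ε x ω - X η y ω) P = gaussianReal 0 v := by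
  obtain ⟨v, hv⟩ := hgauss 2 ![1, -1] ![(⟨ε, hε⟩, ⟨x, hx⟩), (⟨η, hη⟩, ⟨y, hy⟩)]
  refine ⟨v, ?_⟩
  rw [← hv]
  congr 1
  ext ω
  simp [Fin.sum_univ_two, sub_eq_add_neg]

/-- two-sided tail bound, polynomial form -/
theorem incr_tail {Ω : Type*} [MeasurableSpace Ω] {P : Measure Ω} [IsProbabilityMeasure P]
    {D : Set E2} {X : ℝ → E2 → Ω → ℝ}
    (hgauss : IsCenteredGaussianProcess P
      (fun p : (Set.Ioc (0:ℝ) 1) × D => X p.1.1 p.2.1))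
    {ε η : ℝ} {x y : E2} (hε : ε ∈ Set.Ioc (0:ℝ) 1) (hx : x ∈ D)
    (hη : η ∈ Set.Ioc (0:ℝ) 1) (hy : y ∈ D) (σ l : ℝ) (hσ : 0 < σ) (hl : 0 < l)
    (hv : ∫ ω, (X ε x ω - X η y ω) ^ 2 ∂P ≤ σ) (j : ℕ) :
    P {ω | l < |X ε x ω - X η y ω|} ≤
      ENNReal.ofReal (2 * j.factorial * (2 * σ / l ^ 2) ^ j) := by
  obtain ⟨v, h1⟩ := gauss_two hgauss hε hx hη hy
  obtain ⟨w, h2⟩ := gauss_two hgauss hη hy hε hx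
  have hv' : ∫ ω, (X η y ω - X ε x ω) ^ 2 ∂P ≤ σ := by
    refine le_trans (le_of_eq ?_) hv
    congr 1; ext ω; ring
  have t1 := gauss_tail P _ v h1 σ l hσ hl.le hv
  have t2 := gauss_tail P _ w h2 σ l hσ hl.le hv'
  have hsub : {ω | l < |X ε x ω - X η y ω|} ⊆
      {ω | l ≤ X ε x ω - X η y ω} ∪ {ω | l ≤ X η y ω - X ε x ω} := by
    intro ω hω
    have hω' : l < |X ε x ω - X η y ω| := hω
    rcases lt_abs.1 hω' with h | h
    · left; exact h.le
    · right; show l ≤ X η y ω - X ε x ω; linarith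
  refine (measure_mono hsub).trans ((measure_union_le _ _).trans ((add_le_add t1 t2).trans ?_))
  rw [← ENNReal.ofReal_add (Real.exp_pos _).le (Real.exp_pos _).le]
  apply ENNReal.ofReal_le_ofReal
  have hpos : 0 < l ^ 2 / (2 * σ) := by positivity
  have h3 := Real.pow_div_factorial_le_exp (l ^ 2 / (2 * σ)) hpos.le j
  have h4 : Real.exp (-(l ^ 2 / (2 * σ))) ≤ j.factorial * (2 * σ / l ^ 2) ^ j := by
    rw [Real.exp_neg]
    have : (j.factorial * (2 * σ / l ^ 2) ^ j : ℝ) = ((l ^ 2 / (2 * σ)) ^ j / j.factorial)⁻¹ := by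
      rw [inv_div, ← inv_div (l ^ 2) (2 * σ), inv_pow, ← div_eq_mul_inv]
    rw [this]
    exact inv_anti₀ (by positivity) h3
  linarith

/-- Grid point of level `m` in the plane. -/
def gp (m : ℕ) (k : ℤ × ℤ) : E2 := !₂[(k.1 : ℝ) / 2 ^ m, (k.2 : ℝ) / 2 ^ m]

/-- Dyadic floor. -/
def fl (m : ℕ) (r : ℝ) : ℝ := (⌊2 ^ m * r⌋ : ℝ) / 2 ^ m

/-- Dyadic index of a point in the plane. -/
def flK (m : ℕ) (x : E2) : ℤ × ℤ := (⌊2 ^ m * x 0⌋, ⌊2 ^ m * x 1⌋)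

/-- Dyadic floor in the plane. -/
def flE (m : ℕ) (x : E2) : E2 := gp m (flK m x)

theorem gp_zero (m : ℕ) (k : ℤ × ℤ) : gp m k 0 = (k.1 : ℝ) / 2 ^ m := by simp [gp]

theorem gp_one (m : ℕ) (k : ℤ × ℤ) : gp m k 1 = (k.2 : ℝ) / 2 ^ m := by simp [gp]

theorem flE_zero (m : ℕ) (x : E2) : flE m x 0 = fl m (x 0) := by simp [flE, gp_zero, flK, fl]

theorem flE_one (m : ℕ) (x : E2) : flE m x 1 = fl m (x 1) := by simp [flE, gp_one, flK, fl]

theorem fl_le (m : ℕ) (r : ℝ) : fl m r ≤ r := by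
  unfold fl
  rw [div_le_iff₀ (by positivity)]
  have := Int.floor_le (2 ^ m * r)
  linarith

theorem lt_fl (m : ℕ) (r : ℝ) : r - 1 / 2 ^ m < fl m r := by
  unfold fl
  rw [lt_div_iff₀ (by positivity), sub_mul]
  have := Int.sub_one_lt_floor (2 ^ m * r)
  have e : (1 / 2 ^ m * 2 ^ m : ℝ) = 1 := by field_simp
  rw [e]
  linarith

theorem fl_abs (m : ℕ) (r : ℝ) : |fl m r - r| ≤ 1 / 2 ^ m := by
  rw [abs_le]
  have := fl_le m r
  have := lt_fl m r
  have : (0:ℝ) < 1 / 2 ^ m := by positivity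
  constructor <;> linarith

theorem fl_succ_abs (m : ℕ) (r : ℝ) : |fl m r - fl (m + 1) r| ≤ 1 / 2 ^ (m + 1) := by
  have e1 : fl m r = ((2 * ⌊2 ^ m * r⌋ : ℤ) : ℝ) / 2 ^ (m + 1) := by
    unfold fl; push_cast; rw [pow_succ]; field_simp
  rw [e1]
  unfold fl
  rw [← sub_div, abs_div, abs_of_pos (show (0:ℝ) < 2 ^ (m + 1) by positivity)]
  gcongr
  have h1 : 2 * ⌊2 ^ m * r⌋ ≤ ⌊2 ^ (m + 1) * r⌋ := by
    rw [Int.le_floor]; push_cast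
    have := Int.floor_le (2 ^ m * r)
    rw [pow_succ]; nlinarith
  have h2 : ⌊2 ^ (m + 1) * r⌋ < 2 * ⌊2 ^ m * r⌋ + 2 := by
    rw [Int.floor_lt]; push_cast
    have := Int.lt_floor_add_one (2 ^ m * r)
    rw [pow_succ]; nlinarith
  have h3 : |2 * ⌊2 ^ m * r⌋ - ⌊2 ^ (m + 1) * r⌋| ≤ 1 := by
    rw [abs_le]; constructor <;> linarith
  exact_mod_cast h3

theorem fl_close (m : ℕ) (r s : ℝ) (h : |r - s| ≤ 1 / 2 ^ m) : |fl m r - fl m s| ≤ 1 / 2 ^ m := by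
  unfold fl
  rw [← sub_div, abs_div, abs_of_pos (show (0:ℝ) < 2 ^ m by positivity)]
  gcongr
  have h' : |2 ^ m * r - 2 ^ m * s| ≤ 1 := by
    rw [← mul_sub, abs_mul, abs_of_pos (show (0:ℝ) < 2 ^ m by positivity)]
    rw [le_div_iff₀ (by positivity)] at h
    linarith
  rw [abs_le] at h'
  have a1 := Int.floor_le (2 ^ m * r)
  have a2 := Int.lt_floor_add_one (2 ^ m * r)
  have b1 := Int.floor_le (2 ^ m * s)
  have b2 := Int.lt_floor_add_one (2 ^ m * s)
  have c1 : ((⌊2 ^ m * r⌋ : ℤ) : ℝ) < ((⌊2 ^ m * s⌋ + 2 : ℤ) : ℝ) := by push_cast; linarith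
  have c2 : ((⌊2 ^ m * s⌋ : ℤ) : ℝ) < ((⌊2 ^ m * r⌋ + 2 : ℤ) : ℝ) := by push_cast; linarith
  have d1 := Int.cast_lt.1 c1
  have d2 := Int.cast_lt.1 c2
  have h3 : |⌊2 ^ m * r⌋ - ⌊2 ^ m * s⌋| ≤ 1 := by
    rw [abs_le]; constructor <;> linarith
  exact_mod_cast h3

theorem norm_le_two (x : E2) (r : ℝ) (h0 : |x 0| ≤ r) (h1 : |x 1| ≤ r) : ‖x‖ ≤ 2 * r := by
  have hr : 0 ≤ r := (abs_nonneg _).trans h0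
  rw [EuclideanSpace.norm_eq, Fin.sum_univ_two]
  rw [Real.sqrt_le_left (by positivity)]
  simp only [Real.norm_eq_abs]
  have := abs_nonneg (x 0)
  have := abs_nonneg (x 1)
  nlinarith

theorem abs_le_norm2 (x : E2) (i : Fin 2) : |x i| ≤ ‖x‖ := by
  simpa using PiLp.norm_apply_le x i

theorem flE_norm (m : ℕ) (x : E2) : ‖flE m x - x‖ ≤ 2 * (1 / 2 ^ m) := by
  apply norm_le_two
  · simpa [flE_zero] using fl_abs m (x 0)
  · simpa [flE_one] using fl_abs m (x 1)

theorem flE_succ_norm (m : ℕ) (x : E2) : ‖flE m x - flE (m + 1) x‖ ≤ 2 * (1 / 2 ^ (m + 1)) := by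
  apply norm_le_two
  · simpa [flE_zero] using fl_succ_abs m (x 0)
  · simpa [flE_one] using fl_succ_abs m (x 1)

theorem flE_close (m : ℕ) (x y : E2) (h : ‖x - y‖ ≤ 1 / 2 ^ m) :
    ‖flE m x - flE m y‖ ≤ 2 * (1 / 2 ^ m) := by
  apply norm_le_two
  · have := fl_close m (x 0) (y 0) ((abs_le_norm2 (x - y) 0).trans h)
    simpa [flE_zero] using this
  · have := fl_close m (x 1) (y 1) ((abs_le_norm2 (x - y) 1).trans h)
    simpa [flE_one] using this

theorem gp_succ (m : ℕ) (k : ℤ × ℤ) : gp m k = gp (m + 1) (2 * k.1, 2 * k.2) := by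
  ext i
  fin_cases i
  · simp [gp, pow_succ]; field_simp
  · simp [gp, pow_succ]; field_simp

/-- The region on which increments at level `m` are controlled. -/
def VV (A : Set E2) (ρ : ℝ) (m : ℕ) : Set (ℝ × E2) :=
  {t | t.1 ∈ Set.Ioc (0:ℝ) 1 ∧ t.2 ∈ A ∧ 1 ≤ t.1 * (2 * ρ ^ 4) ^ m}

/-- Increments between grid neighbours are eventually small. -/
def Good (A : Set E2) (ρ : ℝ) (f : ℝ → E2 → ℝ) : Prop :=
  ∀ᶠ m : ℕ in atTop, ∀ (i i' : ℤ) (k k' : ℤ × ℤ),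
    ((i : ℝ) / 2 ^ m, gp m k) ∈ VV A ρ m → ((i' : ℝ) / 2 ^ m, gp m k') ∈ VV A ρ m →
    |(i : ℝ) / 2 ^ m - (i' : ℝ) / 2 ^ m| ≤ 1 / 2 ^ m → ‖gp m k - gp m k'‖ ≤ 2 * (1 / 2 ^ m) →
    |f ((i : ℝ) / 2 ^ m) (gp m k) - f ((i' : ℝ) / 2 ^ m) (gp m k')| ≤ ρ ^ m

/-- The increment bound. -/
def IncrBd {Ω : Type*} [MeasurableSpace Ω] (P : Measure Ω) (X : ℝ → E2 → Ω → ℝ) (A : Set E2)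
    (C : ℝ) : Prop :=
  ∀ ε ∈ Set.Ioc (0:ℝ) 1, ∀ η ∈ Set.Ioc (0:ℝ) 1, ∀ x ∈ A, ∀ y ∈ A,
      ∫ ω, (X ε x ω - X η y ω) ^ 2 ∂P ≤ C * (‖x - y‖ + |η - ε|) / min η ε

theorem incr_tail_VV {Ω : Type*} [MeasurableSpace Ω] {P : Measure Ω} [IsProbabilityMeasure P]
    {D : Set E2} {X : ℝ → E2 → Ω → ℝ}
    (hgauss : IsCenteredGaussianProcess P
      (fun p : (Set.Ioc (0:ℝ) 1) × D => X p.1.1 p.2.1))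
    {A : Set E2} (hAD : A ⊆ D) {C : ℝ} (hC : 0 < C) (hb : IncrBd P X A C)
    {ρ : ℝ} (hρ : 0 < ρ) (m : ℕ) (s t : ℝ × E2) (hs : s ∈ VV A ρ m) (ht : t ∈ VV A ρ m)
    (h1 : |s.1 - t.1| ≤ 1 / 2 ^ m) (h2 : ‖s.2 - t.2‖ ≤ 2 * (1 / 2 ^ m)) (j : ℕ) :
    P {ω | ρ ^ m < |X s.1 s.2 ω - X t.1 t.2 ω|} ≤
      ENNReal.ofReal (2 * j.factorial * (6 * C) ^ j * (ρ ^ (2 * j)) ^ m) := by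
  obtain ⟨hs1, hs2, hs3⟩ := hs
  obtain ⟨ht1, ht2, ht3⟩ := ht
  have hmin : 0 < min t.1 s.1 := lt_min ht1.1 hs1.1
  have hmin' : 1 ≤ min t.1 s.1 * (2 * ρ ^ 4) ^ m := by
    rcases min_choice t.1 s.1 with h | h <;> rw [h] <;> assumption
  have hv : ∫ ω, (X s.1 s.2 ω - X t.1 t.2 ω) ^ 2 ∂P ≤ 3 * C * ρ ^ (4 * m) := by
    refine (hb s.1 hs1 t.1 ht1 s.2 hs2 t.2 ht2).trans ?_
    rw [div_le_iff₀ hmin]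
    have h3 : ‖s.2 - t.2‖ + |t.1 - s.1| ≤ 3 * (1 / 2 ^ m) := by
      rw [abs_sub_comm]; linarith
    calc C * (‖s.2 - t.2‖ + |t.1 - s.1|) ≤ C * (3 * (1 / 2 ^ m)) := by gcongr
      _ = C * (3 * (1 / 2 ^ m)) * 1 := by ring
      _ ≤ C * (3 * (1 / 2 ^ m)) * (min t.1 s.1 * (2 * ρ ^ 4) ^ m) := by gcongr
      _ = 3 * C * ρ ^ (4 * m) * min t.1 s.1 := by
        rw [mul_pow, ← pow_mul]; field_simp
  refine (incr_tail hgauss hs1 (hAD hs2) ht1 (hAD ht2) (3 * C * ρ ^ (4 * m)) (ρ ^ m)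
    (by positivity) (by positivity) hv j).trans (le_of_eq ?_)
  congr 1
  have : 2 * (3 * C * ρ ^ (4 * m)) / (ρ ^ m) ^ 2 = 6 * C * (ρ ^ 2) ^ m := by
    rw [div_eq_iff (by positivity)]; ring
  rw [this, mul_pow]; ring

theorem exists_pow_small (ρ : ℝ) (h0 : 0 < ρ) (h1 : ρ < 1) : ∃ j : ℕ, 64 * ρ ^ (2 * j) < 1 := by
  obtain ⟨j, hj⟩ := exists_pow_lt_of_lt_one (show (0:ℝ) < 1 / 64 by norm_num)
    (show ρ ^ 2 < 1 by nlinarith)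
  exact ⟨j, by rw [pow_mul]; linarith⟩

theorem tsum_geom_ne_top (K r : ℝ) (hK : 0 ≤ K) (hr : 0 ≤ r) (hr1 : r < 1) (u : ℕ → ENNReal)
    (hu : ∀ m, u m ≤ ENNReal.ofReal (K * r ^ m)) : ∑' m, u m ≠ ⊤ := by
  have hsum : Summable (fun m : ℕ => K * r ^ m) := (summable_geometric_of_lt_one hr hr1).mul_left K
  refine ne_top_of_le_ne_top ?_ (ENNReal.tsum_le_tsum hu)
  rw [← ENNReal.ofReal_tsum_of_nonneg (fun m => by positivity) hsum]
  exact ENNReal.ofReal_ne_top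

theorem card_box (R : ℕ) (hR : 1 ≤ R) (m : ℕ) :
    ((Finset.Icc (-(R * 2 ^ m : ℤ)) (R * 2 ^ m)).card : ℝ) ≤ 3 * R * 2 ^ m := by
  rw [Int.card_Icc]
  have : (R * 2 ^ m + 1 - -(R * 2 ^ m) : ℤ).toNat = 2 * R * 2 ^ m + 1 := by
    have : (R * 2 ^ m + 1 - -(R * 2 ^ m) : ℤ) = ((2 * R * 2 ^ m + 1 : ℕ) : ℤ) := by
      push_cast; ring
    rw [this, Int.toNat_natCast]
  rw [this]
  push_cast
  have h1 : (1:ℝ) ≤ R := by exact_mod_cast hR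
  have h2 : (1:ℝ) ≤ 2 ^ m := one_le_pow₀ (by norm_num)
  nlinarith

theorem mem_box (R : ℕ) (m : ℕ) (i : ℤ) (h : |(i : ℝ) / 2 ^ m| ≤ R) :
    i ∈ Finset.Icc (-(R * 2 ^ m : ℤ)) (R * 2 ^ m) := by
  rw [abs_div, abs_of_pos (show (0:ℝ) < 2 ^ m by positivity), div_le_iff₀ (by positivity)] at h
  rw [Finset.mem_Icc, ← abs_le]
  exact_mod_cast h

theorem mem_box_gp (R : ℕ) (m : ℕ) (k : ℤ × ℤ) (h : ‖gp m k‖ ≤ R) :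
    k ∈ Finset.Icc (-(R * 2 ^ m : ℤ)) (R * 2 ^ m) ×ˢ Finset.Icc (-(R * 2 ^ m : ℤ)) (R * 2 ^ m) := by
  rw [Finset.mem_product]
  constructor
  · apply mem_box
    rw [← gp_zero]; exact (abs_le_norm2 _ _).trans h
  · apply mem_box
    rw [← gp_one]; exact (abs_le_norm2 _ _).trans h

theorem good_ae {Ω : Type*} [MeasurableSpace Ω] {P : Measure Ω} [IsProbabilityMeasure P]
    {D : Set E2} {X : ℝ → E2 → Ω → ℝ}
    (hgauss : IsCenteredGaussianProcess P
      (fun p : (Set.Ioc (0:ℝ) 1) × D => X p.1.1 p.2.1))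
    {A : Set E2} (hAD : A ⊆ D) {C : ℝ} (hC : 0 < C) (hb : IncrBd P X A C)
    (R : ℕ) (hR : 1 ≤ R) (hAR : ∀ x ∈ A, ‖x‖ ≤ R)
    {ρ : ℝ} (hρ : 0 < ρ) (hρ1 : ρ < 1) :
    ∀ᵐ ω ∂P, Good A ρ (fun ε x => X ε x ω) := by
  classical
  obtain ⟨j, hj⟩ := exists_pow_small ρ hρ hρ1
  set F : ℕ → Finset ℤ := fun m => Finset.Icc (-(R * 2 ^ m : ℤ)) (R * 2 ^ m) with hF
  set FF : ℕ → Finset ((ℤ × ℤ × ℤ) × (ℤ × ℤ × ℤ)) := fun m =>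
    (F m ×ˢ F m ×ˢ F m) ×ˢ (F m ×ˢ F m ×ˢ F m) with hFF
  set K : ℝ := 2 * j.factorial * (6 * C) ^ j with hK
  have hK0 : 0 ≤ K := by positivity
  let T : (m : ℕ) → ((ℤ × ℤ × ℤ) × (ℤ × ℤ × ℤ)) → Set Ω := fun m p =>
    {ω | ((p.1.1 : ℝ) / 2 ^ m, gp m p.1.2) ∈ VV A ρ m ∧ ((p.2.1 : ℝ) / 2 ^ m, gp m p.2.2) ∈ VV A ρ m ∧
      |(p.1.1 : ℝ) / 2 ^ m - (p.2.1 : ℝ) / 2 ^ m| ≤ 1 / 2 ^ m ∧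
      ‖gp m p.1.2 - gp m p.2.2‖ ≤ 2 * (1 / 2 ^ m) ∧
      ρ ^ m < |X ((p.1.1 : ℝ) / 2 ^ m) (gp m p.1.2) ω - X ((p.2.1 : ℝ) / 2 ^ m) (gp m p.2.2) ω|}
  have hT : ∀ m p, P (T m p) ≤ ENNReal.ofReal (K * (ρ ^ (2 * j)) ^ m) := by
    intro m p
    by_cases hc : ((p.1.1 : ℝ) / 2 ^ m, gp m p.1.2) ∈ VV A ρ m ∧
      ((p.2.1 : ℝ) / 2 ^ m, gp m p.2.2) ∈ VV A ρ m ∧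
      |(p.1.1 : ℝ) / 2 ^ m - (p.2.1 : ℝ) / 2 ^ m| ≤ 1 / 2 ^ m ∧
      ‖gp m p.1.2 - gp m p.2.2‖ ≤ 2 * (1 / 2 ^ m)
    · obtain ⟨c1, c2, c3, c4⟩ := hc
      refine le_trans (measure_mono ?_) (incr_tail_VV hgauss hAD hC hb hρ m _ _ c1 c2 c3 c4 j)
      intro ω hω
      exact hω.2.2.2.2
    · have : T m p = ∅ := by
        ext ω
        simp only [Set.mem_empty_iff_false, iff_false]
        intro hω
        exact hc ⟨hω.1, hω.2.1, hω.2.2.1, hω.2.2.2.1⟩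
      rw [this]; simp
  have hcard : ∀ m, ((FF m).card : ℝ) ≤ (3 * R) ^ 6 * 64 ^ m := by
    intro m
    have h := card_box R hR m
    have e : ((FF m).card : ℝ) = ((F m).card : ℝ) ^ 6 := by
      simp only [hFF, Finset.card_product]; push_cast; ring
    rw [e]
    calc ((F m).card : ℝ) ^ 6 ≤ (3 * (R : ℝ) * 2 ^ m) ^ 6 := by gcongr
      _ = (3 * (R : ℝ)) ^ 6 * 64 ^ m := by
        rw [mul_pow, ← pow_mul, mul_comm m 6, pow_mul]; norm_num
  have hsum : ∑' m, P (⋃ p ∈ FF m, T m p) ≠ ⊤ := by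
    refine tsum_geom_ne_top ((3 * R) ^ 6 * K) (64 * ρ ^ (2 * j)) (by positivity) (by positivity) hj
      _ ?_
    intro m
    calc P (⋃ p ∈ FF m, T m p) ≤ ∑ p ∈ FF m, P (T m p) := measure_biUnion_finset_le _ _
      _ ≤ ∑ p ∈ FF m, ENNReal.ofReal (K * (ρ ^ (2 * j)) ^ m) := Finset.sum_le_sum fun p _ => hT m p
      _ = ENNReal.ofReal ((FF m).card * (K * (ρ ^ (2 * j)) ^ m)) := by
        rw [Finset.sum_const, nsmul_eq_mul, ← ENNReal.ofReal_natCast,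
          ← ENNReal.ofReal_mul (Nat.cast_nonneg _)]
      _ ≤ _ := by
        apply ENNReal.ofReal_le_ofReal
        calc ((FF m).card * (K * (ρ ^ (2 * j)) ^ m) : ℝ)
            ≤ ((3 * R) ^ 6 * 64 ^ m) * (K * (ρ ^ (2 * j)) ^ m) := by
              gcongr; exact hcard m
          _ = _ := by rw [mul_pow]; ring
  filter_upwards [ae_eventually_notMem hsum] with ω hω
  filter_upwards [hω] with m hm i i' k k' c1 c2 c3 c4
  by_contra hcon
  push Not at hcon
  apply hm
  have hmem : ∀ (i : ℤ) (k : ℤ × ℤ), ((i : ℝ) / 2 ^ m, gp m k) ∈ VV A ρ m →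
      (i, k) ∈ (F m ×ˢ F m ×ˢ F m) := by
    intro i k h
    rw [Finset.mem_product]
    refine ⟨?_, mem_box_gp R m k (hAR _ h.2.1)⟩
    apply mem_box
    rw [abs_of_pos h.1.1]
    exact h.1.2.trans (by exact_mod_cast hR)
  refine Set.mem_biUnion (x := ((i, k), (i', k'))) ?_ ⟨c1, c2, c3, c4, hcon⟩
  exact Finset.mem_coe.2 (Finset.mem_product.2 ⟨hmem i k c1, hmem i' k' c2⟩)

/-- `m₀` is a level beyond which the increments are controlled. -/
def GoodFrom (A : Set E2) (ρ : ℝ) (f : ℝ → E2 → ℝ) (m₀ : ℕ) : Prop :=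
  ∀ m ≥ m₀, ∀ (i i' : ℤ) (k k' : ℤ × ℤ),
    ((i : ℝ) / 2 ^ m, gp m k) ∈ VV A ρ m → ((i' : ℝ) / 2 ^ m, gp m k') ∈ VV A ρ m →
    |(i : ℝ) / 2 ^ m - (i' : ℝ) / 2 ^ m| ≤ 1 / 2 ^ m → ‖gp m k - gp m k'‖ ≤ 2 * (1 / 2 ^ m) →
    |f ((i : ℝ) / 2 ^ m) (gp m k) - f ((i' : ℝ) / 2 ^ m) (gp m k')| ≤ ρ ^ m

theorem VV_succ {A : Set E2} {ρ : ℝ} (hρ2 : 1 ≤ 2 * ρ ^ 4) {m : ℕ} {t : ℝ × E2}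
    (h : t ∈ VV A ρ m) : t ∈ VV A ρ (m + 1) := by
  refine ⟨h.1, h.2.1, h.2.2.trans ?_⟩
  have := h.1.1.le
  gcongr
  omega

theorem chain {A : Set E2} {ρ : ℝ} (hρ : 0 < ρ) (hρ1 : ρ < 1) (hρ2 : 1 ≤ 2 * ρ ^ 4)
    {f : ℝ → E2 → ℝ} {M : ℕ} (hg : GoodFrom A ρ f M) (m₀ : ℕ) (hM : M ≤ m₀)
    {ε : ℝ} {x : E2} (hV : ∀ m ≥ m₀, (fl m ε, flE m x) ∈ VV A ρ m) :
    ∃ z, Tendsto (fun m => f (fl m ε) (flE m x)) atTop (nhds z) ∧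
      ∀ m ≥ m₀, |f (fl m ε) (flE m x) - z| ≤ ρ ^ m / (1 - ρ) := by
  have hstep : ∀ m ≥ m₀, |f (fl m ε) (flE m x) - f (fl (m + 1) ε) (flE (m + 1) x)| ≤ ρ ^ m := by
    intro m hm
    have h1 := VV_succ hρ2 (hV m hm)
    have h2 := hV (m + 1) (by omega)
    have h3 := fl_succ_abs m ε
    have h4 := flE_succ_norm m x
    have e1 : fl m ε = ((2 * ⌊2 ^ m * ε⌋ : ℤ) : ℝ) / 2 ^ (m + 1) := by
      unfold fl; push_cast; rw [pow_succ]; field_simp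
    have e2 : flE m x = gp (m + 1) (2 * (flK m x).1, 2 * (flK m x).2) := gp_succ _ _
    rw [e1, e2] at h1
    rw [e1] at h3
    rw [e2] at h4
    have := hg (m + 1) (by omega) _ _ _ _ h1 h2 h3 h4
    rw [← e1, ← e2] at this
    refine (show _ ≤ ρ ^ (m + 1) from this).trans ?_
    exact pow_le_pow_of_le_one hρ.le hρ1.le (by omega)
  let u : ℕ → ℝ := fun n => f (fl (n + m₀) ε) (flE (n + m₀) x)
  have hu : ∀ n, dist (u n) (u (n + 1)) ≤ ρ ^ m₀ * ρ ^ n := by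
    intro n
    have := hstep (n + m₀) (by omega)
    rw [Real.dist_eq, ← pow_add, add_comm m₀ n]
    have e : n + 1 + m₀ = n + m₀ + 1 := by omega
    simp only [u]
    rw [e]
    exact this
  obtain ⟨z, hz⟩ := cauchySeq_tendsto_of_complete (cauchySeq_of_le_geometric ρ (ρ ^ m₀) hρ1 hu)
  refine ⟨z, (tendsto_add_atTop_iff_nat m₀).1 hz, ?_⟩
  intro m hm
  have := dist_le_of_le_geometric_of_tendsto ρ (ρ ^ m₀) hρ1 hu hz (m - m₀)
  rw [Real.dist_eq, ← pow_add] at this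
  simp only [u] at this
  have e : m - m₀ + m₀ = m := by omega
  have e' : m₀ + (m - m₀) = m := by omega
  rwa [e, e'] at this

theorem tendsto_half_pow : Tendsto (fun m : ℕ => (1:ℝ) / 2 ^ m) atTop (nhds 0) := by
  have := tendsto_pow_atTop_nhds_zero_of_lt_one (r := (1:ℝ) / 2) (by norm_num) (by norm_num)
  simpa [div_pow] using this

theorem VV_nbhd {A : Set E2} (hA : IsOpen A) {ρ : ℝ} (hρ2 : 1 < 2 * ρ ^ 4) {ε₀ : ℝ} (hε : 0 < ε₀)
    {x₀ : E2} (hx : x₀ ∈ A) :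
    ∃ r > 0, ∃ m₀ : ℕ, ∀ ε x, ε ∈ Set.Ioc (0:ℝ) 1 → |ε - ε₀| < r → ‖x - x₀‖ < r →
      ∀ m ≥ m₀, (fl m ε, flE m x) ∈ VV A ρ m := by
  obtain ⟨r, hr, hball⟩ := Metric.isOpen_iff.1 hA x₀ hx
  have h1 : ∀ᶠ m : ℕ in atTop, (1:ℝ) / 2 ^ m < min (ε₀ / 4) (r / 4) :=
    (tendsto_order.1 tendsto_half_pow).2 _ (by positivity)
  have h2 : ∀ᶠ m : ℕ in atTop, 4 / ε₀ ≤ (2 * ρ ^ 4) ^ m :=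
    (tendsto_pow_atTop_atTop_of_one_lt hρ2).eventually_ge_atTop _
  obtain ⟨m₀, hm₀⟩ := eventually_atTop.1 (h1.and h2)
  refine ⟨min (ε₀ / 2) (r / 2), by positivity, m₀, ?_⟩
  intro ε x hε1 hεd hxd m hm
  obtain ⟨a1, a2⟩ := hm₀ m hm
  have a3 := a1.trans_le (min_le_left _ _)
  have a4 := a1.trans_le (min_le_right _ _)
  have b1 := hεd.trans_le (min_le_left _ _)
  have b2 := hxd.trans_le (min_le_right _ _)
  rw [abs_lt] at b1
  have c1 := lt_fl m ε
  have c2 := fl_le m ε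
  have c3 : ε₀ / 4 ≤ fl m ε := by linarith
  refine ⟨⟨by linarith, c2.trans hε1.2⟩, ?_, ?_⟩
  · apply hball
    rw [Metric.mem_ball, dist_eq_norm]
    have := flE_norm m x
    calc ‖flE m x - x₀‖ = ‖(flE m x - x) + (x - x₀)‖ := by congr 1; abel
      _ ≤ ‖flE m x - x‖ + ‖x - x₀‖ := norm_add_le _ _
      _ < r := by linarith
  · calc (1:ℝ) = ε₀ / 4 * (4 / ε₀) := by field_simp
      _ ≤ fl m ε * (2 * ρ ^ 4) ^ m := by gcongr; linarith

/-- The continuous modification. -/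
def XX {Ω : Type*} (X : ℝ → E2 → Ω → ℝ) (ε : ℝ) (x : E2) (ω : Ω) : ℝ :=
  limUnder atTop (fun m => X (fl m ε) (flE m x) ω)

theorem Good.exists_level {A : Set E2} {ρ : ℝ} {f : ℝ → E2 → ℝ} (h : Good A ρ f) :
    ∃ M, GoodFrom A ρ f M := by
  obtain ⟨M, hM⟩ := eventually_atTop.1 h
  exact ⟨M, hM⟩

theorem XX_cont {Ω : Type*} (X : ℝ → E2 → Ω → ℝ) (ω : Ω) {A D : Set E2} (hA : IsOpen A)
    {ρ : ℝ} (hρ : 0 < ρ) (hρ1 : ρ < 1) (hρ2 : 1 < 2 * ρ ^ 4)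
    (hg : Good A ρ (fun ε x => X ε x ω)) {ε₀ : ℝ} (hε : ε₀ ∈ Set.Ioc (0:ℝ) 1)
    {x₀ : E2} (hx : x₀ ∈ A) :
    ContinuousWithinAt (fun p : ℝ × E2 => XX X p.1 p.2 ω) (Set.Ioc (0:ℝ) 1 ×ˢ D) (ε₀, x₀) := by
  obtain ⟨M, hM⟩ := hg.exists_level
  obtain ⟨r, hr, m₀, hm₀⟩ := VV_nbhd hA hρ2 hε.1 hx
  have hlim : ∀ ε x, ε ∈ Set.Ioc (0:ℝ) 1 → |ε - ε₀| < r → ‖x - x₀‖ < r → ∀ m ≥ max m₀ M,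
      |X (fl m ε) (flE m x) ω - XX X ε x ω| ≤ ρ ^ m / (1 - ρ) := by
    intro ε x h1 h2 h3 m hm
    obtain ⟨z, hz, hz'⟩ := chain hρ hρ1 hρ2.le hM (max m₀ M) (le_max_right _ _) (ε := ε) (x := x)
      (fun m hm => hm₀ ε x h1 h2 h3 m ((le_max_left _ _).trans hm))
    have : XX X ε x ω = z := hz.limUnder_eq
    rw [this]
    exact hz' m hm
  rw [Metric.continuousWithinAt_iff]
  intro e he
  have hK : Tendsto (fun m : ℕ => ρ ^ m * (1 + 2 / (1 - ρ))) atTop (nhds 0) := by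
    simpa using (tendsto_pow_atTop_nhds_zero_of_lt_one hρ.le hρ1).mul_const (1 + 2 / (1 - ρ))
  obtain ⟨m, hm1, hm2⟩ := (((tendsto_order.1 hK).2 e he).and (eventually_ge_atTop (max m₀ M))).exists
  refine ⟨min r (1 / 2 ^ m), by positivity, ?_⟩
  rintro ⟨ε, x⟩ hp hd
  have hp1 : ε ∈ Set.Ioc (0:ℝ) 1 := hp.1
  have hd1 : |ε - ε₀| < min r (1 / 2 ^ m) := by
    refine lt_of_le_of_lt ?_ hd
    rw [← Real.dist_eq]; exact le_max_left _ _
  have hd2 : ‖x - x₀‖ < min r (1 / 2 ^ m) := by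
    refine lt_of_le_of_lt ?_ hd
    rw [← dist_eq_norm]; exact le_max_right _ _
  have k1 := hlim ε x hp1 (hd1.trans_le (min_le_left _ _)) (hd2.trans_le (min_le_left _ _)) m hm2
  have k2 := hlim ε₀ x₀ hε (by simpa using hr) (by simpa using hr) m hm2
  have v1 := hm₀ ε x hp1 (hd1.trans_le (min_le_left _ _)) (hd2.trans_le (min_le_left _ _)) m
    ((le_max_left _ _).trans hm2)
  have v2 := hm₀ ε₀ x₀ hε (by simpa using hr) (by simpa using hr) m
    ((le_max_left _ _).trans hm2)
  have k3 : |X (fl m ε) (flE m x) ω - X (fl m ε₀) (flE m x₀) ω| ≤ ρ ^ m :=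
    hM m ((le_max_right _ _).trans hm2) _ _ _ _ v1 v2
      (fl_close m ε ε₀ (hd1.le.trans (min_le_right _ _)))
      (flE_close m x x₀ (hd2.le.trans (min_le_right _ _)))
  have e0 : ρ ^ m * (1 + 2 / (1 - ρ)) = ρ ^ m + ρ ^ m / (1 - ρ) + ρ ^ m / (1 - ρ) := by ring
  rw [e0] at hm1
  rw [Real.dist_eq]
  show |XX X ε x ω - XX X ε₀ x₀ ω| < e
  rw [abs_le] at k1 k2 k3
  rw [abs_lt]
  constructor <;> linarith [k1.1, k1.2, k2.1, k2.2, k3.1, k3.2]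

theorem XX_modif {Ω : Type*} [MeasurableSpace Ω] {P : Measure Ω} [IsProbabilityMeasure P]
    {D : Set E2} {X : ℝ → E2 → Ω → ℝ}
    (hgauss : IsCenteredGaussianProcess P
      (fun p : (Set.Ioc (0:ℝ) 1) × D => X p.1.1 p.2.1))
    {A : Set E2} (hAo : IsOpen A) (hAD : A ⊆ D) {C : ℝ} (hC : 0 < C) (hb : IncrBd P X A C)
    {ρ : ℝ} (hρ : 0 < ρ) (hρ1 : ρ < 1) (hρ2 : 1 < 2 * ρ ^ 4)
    {ε : ℝ} (hε : ε ∈ Set.Ioc (0:ℝ) 1) {x : E2} (hx : x ∈ A) :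
    ∀ᵐ ω ∂P, XX X ε x ω = X ε x ω := by
  obtain ⟨r, hr, m₀, hm₀⟩ := VV_nbhd hAo hρ2 hε.1 hx
  obtain ⟨j, hj⟩ := exists_pow_small ρ hρ hρ1
  have hj' : ρ ^ (2 * j) < 1 := by
    have : 0 < ρ ^ (2 * j) := by positivity
    linarith
  have hsum : ∑' m, P {ω | m₀ ≤ m ∧ ρ ^ m < |X (fl m ε) (flE m x) ω - X ε x ω|} ≠ ⊤ := by
    refine tsum_geom_ne_top (2 * j.factorial * (6 * C) ^ j) (ρ ^ (2 * j)) (by positivity)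
      (by positivity) hj' _ ?_
    intro m
    by_cases hm : m₀ ≤ m
    · have v1 := hm₀ ε x hε (by simpa using hr) (by simpa using hr) m hm
      have v2 : (ε, x) ∈ VV A ρ m := by
        refine ⟨hε, hx, v1.2.2.trans ?_⟩
        have := fl_le m ε
        gcongr
      refine le_trans (measure_mono ?_) (incr_tail_VV hgauss hAD hC hb hρ m _ _ v1 v2
        (fl_abs m ε) (flE_norm m x) j)
      intro ω hω
      exact hω.2
    · have : {ω | m₀ ≤ m ∧ ρ ^ m < |X (fl m ε) (flE m x) ω - X ε x ω|} = ∅ := by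
        ext ω; simp [hm]
      rw [this]; simp
  filter_upwards [ae_eventually_notMem hsum] with ω hω
  apply Tendsto.limUnder_eq
  rw [tendsto_iff_dist_tendsto_zero]
  refine squeeze_zero' (Eventually.of_forall fun _ => dist_nonneg) ?_
    (tendsto_pow_atTop_nhds_zero_of_lt_one hρ.le hρ1)
  filter_upwards [hω, eventually_ge_atTop m₀] with m hm hm'
  rw [Real.dist_eq]
  by_contra hcon
  push Not at hcon
  exact hm ⟨hm', hcon⟩

theorem dimH_of_cover (S : Set E2) (N : ℕ) (hN : 1 ≤ N) (H : ℕ → Finset (ℤ × ℤ)) (s : ℝ) (hs : 0 < s)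
    (hcard : ∀ᶠ l in atTop, ((H l).card : ℝ) < (2:ℝ) ^ (s * ((N * l : ℕ) : ℝ)))
    (hS : ∀ x ∈ S, ∀ᶠ l in atTop, flK (N * l) x ∈ H l) : dimH S ≤ ENNReal.ofReal s := by
  have hSU : S ⊆ ⋃ n : ℕ, {x | ∀ l ≥ n, flK (N * l) x ∈ H l} := by
    intro x hx
    obtain ⟨n, hn⟩ := eventually_atTop.1 (hS x hx)
    exact Set.mem_iUnion.2 ⟨n, hn⟩
  refine (dimH_mono hSU).trans ?_
  rw [dimH_iUnion]
  refine iSup_le fun n => ?_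
  set S' : Set E2 := {x | ∀ l ≥ n, flK (N * l) x ∈ H l} with hS'
  have hd : ∀ l : ℕ, ∀ k : ℤ × ℤ, Metric.ediam {x : E2 | flK (N * l) x = k} ≤
      ENNReal.ofReal (4 * (1 / 2 ^ (N * l))) := by
    intro l k
    apply Metric.ediam_le
    intro x hx y hy
    rw [edist_dist]
    apply ENNReal.ofReal_le_ofReal
    have h1 := flE_norm (N * l) x
    have h2 := flE_norm (N * l) y
    have e : flE (N * l) x = flE (N * l) y := by
      have hx' : flK (N * l) x = k := hx
      have hy' : flK (N * l) y = k := hy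
      unfold flE; rw [hx', hy']
    rw [e] at h1
    rw [dist_eq_norm]
    calc ‖x - y‖ = ‖(flE (N * l) y - y) - (flE (N * l) y - x)‖ := by congr 1; abel
      _ ≤ ‖flE (N * l) y - y‖ + ‖flE (N * l) y - x‖ := norm_sub_le _ _
      _ ≤ _ := by linarith
  have hNl : Tendsto (fun l : ℕ => N * l) atTop atTop := by
    apply tendsto_atTop_mono (fun l => ?_) tendsto_id
    simp only [id]; nlinarith
  have key : μH[s] S' ≤ ENNReal.ofReal (4 ^ s) := by
    have h1 := Measure.hausdorffMeasure_le_liminf_sum (X := E2) (ι := fun l : ℕ => {k // k ∈ H l}) s S'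
      (l := atTop) (fun l : ℕ => ENNReal.ofReal (4 * (1 / 2 ^ (N * l)))) ?_
      (fun l k => {x : E2 | flK (N * l) x = k.1}) (Eventually.of_forall fun l k => hd l k.1) ?_
    · refine h1.trans ?_
      refine (liminf_le_liminf (v := fun _ => ENNReal.ofReal (4 ^ s)) ?_).trans ?_
      · filter_upwards [hcard] with l hl
        calc ∑ k : {k // k ∈ H l}, Metric.ediam {x : E2 | flK (N * l) x = k.1} ^ s
            ≤ ∑ k : {k // k ∈ H l}, ENNReal.ofReal (4 * (1 / 2 ^ (N * l))) ^ s := by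
              gcongr with k
              exact hd l k.1
          _ = ENNReal.ofReal ((H l).card * (4 * (1 / 2 ^ (N * l))) ^ s) := by
              rw [Finset.sum_const, nsmul_eq_mul, Finset.card_univ, Fintype.card_coe,
                ENNReal.ofReal_rpow_of_nonneg (by positivity) hs.le, ← ENNReal.ofReal_natCast,
                ← ENNReal.ofReal_mul (Nat.cast_nonneg _)]
          _ ≤ ENNReal.ofReal (4 ^ s) := by
              apply ENNReal.ofReal_le_ofReal
              have e : ((4:ℝ) * (1 / 2 ^ (N * l))) ^ s = 4 ^ s * ((2:ℝ) ^ (s * ((N * l : ℕ) : ℝ)))⁻¹ := by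
                rw [Real.mul_rpow (by norm_num) (by positivity), one_div,
                  Real.inv_rpow (by positivity), mul_comm s, Real.rpow_mul (by norm_num),
                  Real.rpow_natCast]
              rw [e]
              calc ((H l).card : ℝ) * (4 ^ s * ((2:ℝ) ^ (s * ((N * l : ℕ) : ℝ)))⁻¹)
                  ≤ (2:ℝ) ^ (s * ((N * l : ℕ) : ℝ)) * (4 ^ s * ((2:ℝ) ^ (s * ((N * l : ℕ) : ℝ)))⁻¹) := by
                    gcongr
                _ = 4 ^ s := by
                    have : (0:ℝ) < (2:ℝ) ^ (s * ((N * l : ℕ) : ℝ)) := by positivity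
                    field_simp
      · simp
    · have := (tendsto_half_pow.comp hNl).const_mul 4
      rw [mul_zero] at this
      simpa using ENNReal.tendsto_ofReal this
    · filter_upwards [eventually_ge_atTop n] with l hl x hx
      exact Set.mem_iUnion.2 ⟨⟨flK (N * l) x, hx l hl⟩, rfl⟩
  have h2 : μH[((s.toNNReal : NNReal) : ℝ)] S' ≠ ⊤ := by
    rw [Real.coe_toNNReal s hs.le]
    exact ne_top_of_le_ne_top ENNReal.ofReal_ne_top key
  exact dimH_le_of_hausdorffMeasure_ne_top h2

/-- The relevant scales. -/
def sc (q l : ℕ) : ℝ := 1 / 2 ^ (q * l)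

theorem sc_mem (q l : ℕ) : sc q l ∈ Set.Ioc (0:ℝ) 1 := by
  unfold sc
  refine ⟨by positivity, ?_⟩
  rw [div_le_one (by positivity)]
  exact one_le_pow₀ (by norm_num)

theorem sc_tendsto (q : ℕ) (hq : 1 ≤ q) :
    Tendsto (fun l => sc q l) atTop (nhdsWithin 0 (Set.Ioi 0)) := by
  refine tendsto_nhdsWithin_iff.2 ⟨?_, Eventually.of_forall fun l => (sc_mem q l).1⟩
  have hNl : Tendsto (fun l : ℕ => q * l) atTop atTop := by
    apply tendsto_atTop_mono (fun l => ?_) tendsto_id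
    simp only [id]; nlinarith
  exact tendsto_half_pow.comp hNl

theorem log_sc (q l : ℕ) : Real.log (1 / sc q l) = q * l * Real.log 2 := by
  unfold sc
  rw [one_div_one_div, Real.log_pow]
  push_cast; ring

theorem fl_sc (q l m : ℕ) (h : q * l ≤ m) : fl m (sc q l) = sc q l := by
  unfold fl sc
  have : (2:ℝ) ^ m * (1 / 2 ^ (q * l)) = ((2 ^ (m - q * l) : ℤ) : ℝ) := by
    push_cast
    rw [mul_one_div, div_eq_iff (by positivity), ← pow_add]
    congr 1; omega
  rw [this, Int.floor_intCast, ← this]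
  field_simp

theorem G_sc {G : ℝ → ℝ}
    (hGlim : Tendsto (fun ε => G ε / Real.log (1 / ε)) (nhdsWithin 0 (Set.Ioi 0)) (nhds 1))
    (q : ℕ) (hq : 1 ≤ q) (θ : ℝ) (hθ : θ < 1) :
    ∀ᶠ l : ℕ in atTop, θ * (q * l * Real.log 2) ≤ G (sc q l) := by
  have h := hGlim.comp (sc_tendsto q hq)
  filter_upwards [(tendsto_order.1 h).1 θ hθ, eventually_ge_atTop 1] with l hl hl1
  simp only [Function.comp, log_sc] at hl
  have : (0:ℝ) < q * l * Real.log 2 := by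
    have := Real.log_pos (show (1:ℝ) < 2 by norm_num)
    have h1 : (0:ℝ) < q := by exact_mod_cast hq
    have h2 : (0:ℝ) < l := by exact_mod_cast hl1
    positivity
  rw [lt_div_iff₀ this] at hl
  exact hl.le

theorem G_sc_atTop {G : ℝ → ℝ}
    (hGlim : Tendsto (fun ε => G ε / Real.log (1 / ε)) (nhdsWithin 0 (Set.Ioi 0)) (nhds 1))
    (q : ℕ) (hq : 1 ≤ q) : Tendsto (fun l => G (sc q l)) atTop atTop := by
  refine tendsto_atTop_mono' _ (G_sc hGlim q hq (1 / 2) (by norm_num)) ?_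
  have hl2 := Real.log_pos (show (1:ℝ) < 2 by norm_num)
  have h1 : (0:ℝ) < q := by exact_mod_cast hq
  have : Tendsto (fun l : ℕ => (1 / 2 * q * Real.log 2) * (l : ℝ)) atTop atTop :=
    tendsto_natCast_atTop_atTop.const_mul_atTop (by positivity)
  refine this.congr fun l => by ring

open Classical in
/-- The cells with large values. -/
def Hit {Ω : Type*} (X : ℝ → E2 → Ω → ℝ) (G : ℝ → ℝ) (A : Set E2) (R : ℕ) (b : ℝ) (q l : ℕ) (ω : Ω) :
    Finset (ℤ × ℤ) :=
  ((Finset.Icc (-(R * 2 ^ ((q + 1) * l) : ℤ)) (R * 2 ^ ((q + 1) * l)) ×ˢ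
    Finset.Icc (-(R * 2 ^ ((q + 1) * l) : ℤ)) (R * 2 ^ ((q + 1) * l))).filter
    (fun k => gp ((q + 1) * l) k ∈ A)).filter
    (fun k => b * G (sc q l) ≤ X (sc q l) (gp ((q + 1) * l) k) ω)

theorem hit_card {Ω : Type*} [MeasurableSpace Ω] {P : Measure Ω} [IsProbabilityMeasure P]
    {D : Set E2} {X : ℝ → E2 → Ω → ℝ}
    (hgauss : IsCenteredGaussianProcess P
      (fun p : (Set.Ioc (0:ℝ) 1) × D => X p.1.1 p.2.1))
    {A : Set E2} (hAD : A ⊆ D) (R : ℕ) (hR : 1 ≤ R) {G : ℝ → ℝ}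
    (hGvar : ∀ ε ∈ Set.Ioc (0:ℝ) 1, ∀ x ∈ D, ∫ ω, (X ε x ω) ^ 2 ∂P = G ε)
    (hGlim : Tendsto (fun ε => G ε / Real.log (1 / ε)) (nhdsWithin 0 (Set.Ioi 0)) (nhds 1))
    (b c s : ℝ) (hb : 0 < b) (hc : c < b ^ 2 / 2) (q : ℕ) (hq : 1 ≤ q)
    (hs : (2 - s) * (q + 1) < c * q) :
    ∀ᵐ ω ∂P, ∀ᶠ l in atTop, ((Hit X G A R b q l ω).card : ℝ) <
      (2:ℝ) ^ (s * (((q + 1) * l : ℕ) : ℝ)) := by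
  classical
  have hl2 := Real.log_pos (show (1:ℝ) < 2 by norm_num)
  have hθ : 2 * c / b ^ 2 < 1 := by rw [div_lt_one (by positivity)]; linarith
  obtain ⟨l₀, hl₀⟩ := eventually_atTop.1 ((G_sc hGlim q hq _ hθ).and
    ((G_sc_atTop hGlim q hq).eventually_gt_atTop 0))
  set r : ℝ := (2:ℝ) ^ (2 * ((q:ℝ) + 1) - c * q - s * (q + 1)) with hr
  have hr1 : r < 1 := Real.rpow_lt_one_of_one_lt_of_neg (by norm_num) (by linarith)
  have hr0 : 0 < r := by positivity
  have hsum : ∑' l : ℕ, P {ω | l₀ ≤ l ∧ (2:ℝ) ^ (s * (((q + 1) * l : ℕ) : ℝ)) ≤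
      ((Hit X G A R b q l ω).card : ℝ)} ≠ ⊤ := by
    refine tsum_geom_ne_top ((3 * R) ^ 2) r (by positivity) hr0.le hr1 _ ?_
    intro l
    by_cases hl : l₀ ≤ l
    swap
    · have : {ω | l₀ ≤ l ∧ (2:ℝ) ^ (s * (((q + 1) * l : ℕ) : ℝ)) ≤
        ((Hit X G A R b q l ω).card : ℝ)} = ∅ := by ext ω; simp [hl]
      rw [this]; simp
    obtain ⟨hG1, hG2⟩ := hl₀ l hl
    set box := (Finset.Icc (-(R * 2 ^ ((q + 1) * l) : ℤ)) (R * 2 ^ ((q + 1) * l)) ×ˢ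
      Finset.Icc (-(R * 2 ^ ((q + 1) * l) : ℤ)) (R * 2 ^ ((q + 1) * l))) with hbox
    set box' := box.filter (fun k => gp ((q + 1) * l) k ∈ A) with hbox'
    let S : ℤ × ℤ → Set Ω := fun k => {ω | b * G (sc q l) ≤ X (sc q l) (gp ((q + 1) * l) k) ω}
    have hSm : ∀ k ∈ box', NullMeasurableSet (S k) P := by
      intro k hk
      obtain ⟨v, hv⟩ := gauss_one hgauss (sc_mem q l) (hAD (Finset.mem_filter.1 hk).2)
      have hm : AEMeasurable (fun ω => X (sc q l) (gp ((q + 1) * l) k) ω) P := by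
        apply aemeasurable_of_map_neZero
        rw [hv]; infer_instance
      exact nullMeasurableSet_le aemeasurable_const hm
    have hSP : ∀ k ∈ box', P (S k) ≤ ENNReal.ofReal ((2:ℝ) ^ (-(c * q * l))) := by
      intro k hk
      have hkD := hAD (Finset.mem_filter.1 hk).2
      obtain ⟨v, hv⟩ := gauss_one hgauss (sc_mem q l) hkD
      refine (gauss_tail P _ v hv (G (sc q l)) (b * G (sc q l)) hG2 (by positivity)
        (hGvar _ (sc_mem q l) _ hkD).le).trans ?_
      apply ENNReal.ofReal_le_ofReal
      rw [Real.rpow_def_of_pos (by norm_num)]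
      apply Real.exp_le_exp.2
      have e : (b * G (sc q l)) ^ 2 / (2 * G (sc q l)) = b ^ 2 / 2 * G (sc q l) := by
        field_simp
      rw [e]
      have : b ^ 2 / 2 * (2 * c / b ^ 2 * (q * l * Real.log 2)) ≤ b ^ 2 / 2 * G (sc q l) := by gcongr
      have e2 : b ^ 2 / 2 * (2 * c / b ^ 2 * (q * l * Real.log 2)) = c * q * l * Real.log 2 := by
        field_simp
      linarith
    have hcardb : (box'.card : ℝ) ≤ (3 * R) ^ 2 * (2:ℝ) ^ (2 * ((q:ℝ) + 1) * l) := by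
      have h1 : (box'.card : ℝ) ≤ box.card := by exact_mod_cast Finset.card_filter_le _ _
      refine h1.trans ?_
      rw [hbox, Finset.card_product]
      push_cast
      have h := card_box R hR ((q + 1) * l)
      have e : (2:ℝ) ^ (2 * ((q:ℝ) + 1) * l) = (2 ^ ((q + 1) * l)) ^ 2 := by
        rw [← pow_mul, ← Real.rpow_natCast]; congr 1; push_cast; ring
      rw [e]
      calc _ ≤ (3 * (R:ℝ) * 2 ^ ((q + 1) * l)) * (3 * R * 2 ^ ((q + 1) * l)) := by gcongr
        _ = _ := by ring
    set T : ℝ := (2:ℝ) ^ (s * (((q + 1) * l : ℕ) : ℝ)) with hT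
    have hT0 : 0 < T := by positivity
    let F : Ω → ENNReal := fun ω => ∑ k ∈ box', (S k).indicator (fun _ => (1:ENNReal)) ω
    have hF : AEMeasurable F P := by
      apply Finset.aemeasurable_fun_sum
      intro k hk
      exact aemeasurable_const.indicator₀ (hSm k hk)
    have hFeq : ∀ ω, F ω = ((Hit X G A R b q l ω).card : ENNReal) := by
      intro ω
      simp only [F, Hit, Set.indicator_apply]
      rw [Finset.card_filter]
      push_cast
      rfl
    have hintg : ∫⁻ ω, F ω ∂P ≤ ENNReal.ofReal ((3 * R) ^ 2 * (2:ℝ) ^ (2 * ((q:ℝ) + 1) * l) *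
        (2:ℝ) ^ (-(c * q * l))) := by
      rw [lintegral_finsetSum' _ (fun k hk => aemeasurable_const.indicator₀ (hSm k hk))]
      calc ∑ k ∈ box', ∫⁻ ω, (S k).indicator (fun _ => (1:ENNReal)) ω ∂P
          = ∑ k ∈ box', P (S k) := by
            apply Finset.sum_congr rfl
            intro k hk
            rw [lintegral_indicator_const₀ (hSm k hk), one_mul]
        _ ≤ ∑ k ∈ box', ENNReal.ofReal ((2:ℝ) ^ (-(c * q * l))) := Finset.sum_le_sum hSP
        _ = ENNReal.ofReal (box'.card * (2:ℝ) ^ (-(c * q * l))) := by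
            rw [Finset.sum_const, nsmul_eq_mul, ← ENNReal.ofReal_natCast,
              ← ENNReal.ofReal_mul (Nat.cast_nonneg _)]
        _ ≤ _ := by
            apply ENNReal.ofReal_le_ofReal
            gcongr
    have hmark := meas_ge_le_lintegral_div hF (ε := ENNReal.ofReal T)
      (by simpa using hT0) ENNReal.ofReal_ne_top
    calc P {ω | l₀ ≤ l ∧ T ≤ ((Hit X G A R b q l ω).card : ℝ)}
        ≤ P {ω | ENNReal.ofReal T ≤ F ω} := by
          apply measure_mono
          intro ω hω
          show ENNReal.ofReal T ≤ F ω
          rw [hFeq, ← ENNReal.ofReal_natCast]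
          exact ENNReal.ofReal_le_ofReal hω.2
      _ ≤ (∫⁻ ω, F ω ∂P) / ENNReal.ofReal T := hmark
      _ ≤ ENNReal.ofReal ((3 * R) ^ 2 * (2:ℝ) ^ (2 * ((q:ℝ) + 1) * l) *
        (2:ℝ) ^ (-(c * q * l))) / ENNReal.ofReal T := by gcongr
      _ = ENNReal.ofReal ((3 * R) ^ 2 * (2:ℝ) ^ (2 * ((q:ℝ) + 1) * l) *
        (2:ℝ) ^ (-(c * q * l)) / T) := (ENNReal.ofReal_div_of_pos hT0).symm
      _ = ENNReal.ofReal ((3 * R) ^ 2 * r ^ l) := by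
          congr 1
          rw [mul_assoc, mul_div_assoc, ← Real.rpow_add (by norm_num), hT,
            ← Real.rpow_sub (by norm_num), hr, ← Real.rpow_natCast _ l, ← Real.rpow_mul (by norm_num)]
          congr 2
          push_cast; ring
  filter_upwards [ae_eventually_notMem hsum] with ω hω
  filter_upwards [hω, eventually_ge_atTop l₀] with l hl hl'
  by_contra hcon
  push Not at hcon
  exact hl ⟨hl', hcon⟩

theorem hit_mem {Ω : Type*} {X : ℝ → E2 → Ω → ℝ} {ω : Ω}
    {A : Set E2} (hAo : IsOpen A) (R : ℕ) (hAR : ∀ x ∈ A, ‖x‖ ≤ R) {G : ℝ → ℝ}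
    (hGlim : Tendsto (fun ε => G ε / Real.log (1 / ε)) (nhdsWithin 0 (Set.Ioi 0)) (nhds 1))
    (b : ℝ) (q : ℕ) (hq : 1 ≤ q) {ρ : ℝ} (hρ : 0 < ρ) (hρ1 : ρ < 1) (hρ2 : 1 < 2 * ρ ^ 4)
    (hρN : 1 / 2 ≤ ρ ^ (4 * (q + 1))) (hg : Good A ρ (fun ε x => X ε x ω))
    {x : E2} (hx : x ∈ A) {L : ℝ} (hL : b < L)
    (hlim : Tendsto (fun ε => XX X ε x ω / G ε) (nhdsWithin 0 (Set.Ioi 0)) (nhds L)) :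
    ∀ᶠ l in atTop, flK ((q + 1) * l) x ∈ Hit X G A R b q l ω := by
  classical
  obtain ⟨M, hM⟩ := hg.exists_level
  obtain ⟨b', hb1, hb2⟩ := exists_between hL
  obtain ⟨r, hr, m₀, hm₀⟩ := VV_nbhd hAo hρ2 one_pos hx
  have hA : ∀ m ≥ m₀, flE m x ∈ A := fun m hm =>
    (hm₀ 1 x (by simp) (by simpa using hr) (by simpa using hr) m hm).2.1
  have h1 := (tendsto_order.1 (hlim.comp (sc_tendsto q hq))).1 b' hb2
  have h2 := (G_sc_atTop hGlim q hq).eventually_gt_atTop 0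
  have h3 := (G_sc_atTop hGlim q hq).eventually_ge_atTop (1 / (1 - ρ) / (b' - b))
  have hρ' : 0 < 1 - ρ := by linarith
  filter_upwards [h1, h2, h3, eventually_ge_atTop (max m₀ M)] with l k1 k2 k3 k4
  have hle : l ≤ (q + 1) * l := Nat.le_mul_of_pos_left l (by omega)
  have hql : q * l ≤ (q + 1) * l := Nat.mul_le_mul_right l (by omega)
  have hV : ∀ m ≥ (q + 1) * l, (fl m (sc q l), flE m x) ∈ VV A ρ m := by
    intro m hm
    rw [fl_sc q l m (hql.trans hm)]
    refine ⟨sc_mem q l, hA m ?_, ?_⟩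
    · exact (le_max_left _ _).trans (k4.trans (hle.trans hm))
    · have e1 : (1:ℝ) ≤ sc q l * (2 * ρ ^ 4) ^ ((q + 1) * l) := by
        have : sc q l * (2 * ρ ^ 4) ^ ((q + 1) * l) = (2 * ρ ^ (4 * (q + 1))) ^ l := by
          unfold sc
          rw [one_div_mul_eq_div, div_eq_iff (by positivity)]
          rw [mul_pow, mul_pow]
          ring
        rw [this]
        apply one_le_pow₀
        linarith
      refine e1.trans ?_
      have := (sc_mem q l).1.le
      gcongr
      exact hρ2.le
  obtain ⟨z, hz, hz'⟩ := chain hρ hρ1 hρ2.le hM ((q + 1) * l)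
    ((le_max_right _ _).trans (k4.trans hle)) hV
  have hzX : XX X (sc q l) x ω = z := hz.limUnder_eq
  have k5 := hz' _ le_rfl
  rw [fl_sc q l _ hql, ← hzX] at k5
  have k6 : ρ ^ ((q + 1) * l) / (1 - ρ) ≤ 1 / (1 - ρ) := by
    gcongr
    exact pow_le_one₀ hρ.le hρ1.le
  simp only [Function.comp] at k1
  rw [lt_div_iff₀ k2] at k1
  rw [div_le_iff₀ (by linarith)] at k3
  have k7 : b * G (sc q l) ≤ X (sc q l) (flE ((q + 1) * l) x) ω := by
    have := (abs_le.1 (k5.trans k6)).1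
    nlinarith
  have k8 : flE ((q + 1) * l) x ∈ A := hA _ ((le_max_left _ _).trans (k4.trans hle))
  unfold Hit
  rw [Finset.mem_filter, Finset.mem_filter]
  exact ⟨⟨mem_box_gp R _ _ (hAR _ k8), k8⟩, k7⟩

theorem exists_rho (q : ℕ) (hq : 1 ≤ q) :
    ∃ ρ : ℝ, 0 < ρ ∧ ρ < 1 ∧ 1 < 2 * ρ ^ 4 ∧ 1 / 2 ≤ ρ ^ (4 * (q + 1)) := by
  have hq' : (1:ℝ) ≤ q := by exact_mod_cast hq
  set u : ℝ := 1 / (8 * (q + 1)) with hu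
  have hu0 : 0 < u := by positivity
  have hu1 : u ≤ 1 / 16 := by
    rw [hu]; apply one_div_le_one_div_of_le (by norm_num); linarith
  have hB : 1 / 2 ≤ (1 + -u) ^ (4 * (q + 1)) := by
    have := one_add_mul_le_pow (a := -u) (by linarith) (4 * (q + 1))
    refine le_trans (le_of_eq ?_) this
    rw [hu]; push_cast; field_simp; norm_num
  refine ⟨1 + -u, by linarith, by linarith, ?_, hB⟩
  have := one_add_mul_le_pow (a := -u) (by linarith) 4
  push_cast at this
  linarith

theorem thick_cover {Ω : Type*} [MeasurableSpace Ω] {P : Measure Ω} [IsProbabilityMeasure P]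
    {D : Set E2} {X : ℝ → E2 → Ω → ℝ}
    (hgauss : IsCenteredGaussianProcess P
      (fun p : (Set.Ioc (0:ℝ) 1) × D => X p.1.1 p.2.1))
    {A : Set E2} (hAo : IsOpen A) (hAD : A ⊆ D) {C : ℝ} (hC : 0 < C) (hib : IncrBd P X A C)
    (R : ℕ) (hR : 1 ≤ R) (hAR : ∀ x ∈ A, ‖x‖ ≤ R) {G : ℝ → ℝ}
    (hGvar : ∀ ε ∈ Set.Ioc (0:ℝ) 1, ∀ x ∈ D, ∫ ω, (X ε x ω) ^ 2 ∂P = G ε)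
    (hGlim : Tendsto (fun ε => G ε / Real.log (1 / ε)) (nhdsWithin 0 (Set.Ioi 0)) (nhds 1))
    (a s : ℝ) (ha : 0 < a) (hs : 2 - s < a ^ 2 / 2) :
    ∀ᵐ ω ∂P, ∃ (N : ℕ) (H : ℕ → Finset (ℤ × ℤ)), 1 ≤ N ∧
      (∀ᶠ l in atTop, ((H l).card : ℝ) < (2:ℝ) ^ (s * ((N * l : ℕ) : ℝ))) ∧
      ∀ x ∈ A, ∀ L, a ≤ L →
        Tendsto (fun ε => XX X ε x ω / G ε) (nhdsWithin 0 (Set.Ioi 0)) (nhds L) →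
        ∀ᶠ l in atTop, flK (N * l) x ∈ H l := by
  set κ : ℝ := max (2 - s) 0 with hκ
  have hκ0 : 0 ≤ κ := le_max_right _ _
  have hκs : 2 - s ≤ κ := le_max_left _ _
  have hκa : κ < a ^ 2 / 2 := max_lt hs (by positivity)
  set w := Real.sqrt (2 * κ) with hw
  have hw0 : 0 ≤ w := Real.sqrt_nonneg _
  have hw2 : w ^ 2 = 2 * κ := Real.sq_sqrt (by linarith)
  have hwa : w < a := by
    apply lt_of_pow_lt_pow_left₀ 2 ha.le; rw [hw2]; linarith
  obtain ⟨b, hb1, hb2⟩ := exists_between hwa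
  have hb0 : 0 < b := by linarith
  have hb3 : κ < b ^ 2 / 2 := by
    have : w ^ 2 < b ^ 2 := by gcongr
    linarith
  obtain ⟨c, hc1, hc2⟩ := exists_between hb3
  obtain ⟨q, hq⟩ := exists_nat_gt (κ / (c - κ))
  have hq1 : 1 ≤ q := by
    have : (0:ℝ) < q := lt_of_le_of_lt (div_nonneg hκ0 (by linarith)) hq
    exact_mod_cast this
  rw [div_lt_iff₀ (by linarith)] at hq
  have hqs : (2 - s) * (q + 1) < c * q := by
    have : (2 - s) * (q + 1) ≤ κ * (q + 1) := by gcongr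
    nlinarith
  obtain ⟨ρ, hρ, hρ1, hρ2, hρN⟩ := exists_rho q hq1
  filter_upwards [good_ae hgauss hAD hC hib R hR hAR hρ hρ1,
    hit_card hgauss hAD R hR hGvar hGlim b c s hb0 hc2 q hq1 hqs] with ω h1 h2
  refine ⟨q + 1, fun l => Hit X G A R b q l ω, by omega, h2, ?_⟩
  intro x hx L hL hlim
  exact hit_mem hAo R hAR hGlim b q hq1 hρ hρ1 hρ2 hρN h1 hx (hb2.trans_le hL) hlim

theorem thick_points_planar_GFF
    (D : Set (EuclideanSpace ℝ (Fin 2)))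
    (hDopen : IsOpen D) (hDbdd : Bornology.IsBounded D)
    (hDconv : Convex ℝ D) (hDne : D.Nonempty)
    {Ω : Type*} [MeasurableSpace Ω] (P : Measure Ω) [IsProbabilityMeasure P]
    (X : ℝ → EuclideanSpace ℝ (Fin 2) → Ω → ℝ)
    (hgauss : IsCenteredGaussianProcess P
      (fun p : (Set.Ioc (0:ℝ) 1) × D => X p.1.1 p.2.1))
    -- the variance does not depend on x and is asymptotically log(1/ε)
    (G : ℝ → ℝ)
    (hGvar : ∀ ε ∈ Set.Ioc (0:ℝ) 1, ∀ x ∈ D, ∫ ω, (X ε x ω) ^ 2 ∂P = G ε)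
    (hGlim : Tendsto (fun ε => G ε / Real.log (1 / ε)) (nhdsWithin 0 (Set.Ioi 0)) (nhds 1))
    -- Hölder-type bound on increments on D^(δ) = {x ∈ D : dist(x, ∂D) > δ}
    (hA : ∀ δ : ℝ, 0 < δ → ∃ C : ℝ, 0 < C ∧
      ∀ ε ∈ Set.Ioc (0:ℝ) 1, ∀ η ∈ Set.Ioc (0:ℝ) 1,
      ∀ x ∈ {z ∈ D | δ < Metric.infDist z (frontier D)},
      ∀ y ∈ {z ∈ D | δ < Metric.infDist z (frontier D)},
      ∫ ω, (X ε x ω - X η y ω) ^ 2 ∂P ≤ C * (‖x - y‖ + |η - ε|) / min η ε) :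
    ∃ X' : ℝ → EuclideanSpace ℝ (Fin 2) → Ω → ℝ,
      -- X' is a modification of X
      (∀ ε ∈ Set.Ioc (0:ℝ) 1, ∀ x ∈ D, ∀ᵐ ω ∂P, X' ε x ω = X ε x ω) ∧
      -- X' is jointly continuous in (ε, x) on (0,1] × D
      (∀ᵐ ω ∂P, ContinuousOn (fun p : ℝ × EuclideanSpace ℝ (Fin 2) => X' p.1 p.2 ω)
        (Set.Ioc (0:ℝ) 1 ×ˢ D)) ∧
      -- upper bound on the Hausdorff dimension of the set of thick points for 0 ≤ a ≤ 2
      (∀ a : ℝ, 0 ≤ a → a ≤ 2 →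
        ∀ᵐ ω ∂P,
          dimH {x : EuclideanSpace ℝ (Fin 2) | x ∈ D ∧
              ∃ L : ℝ, a ≤ L ∧
                Tendsto (fun ε => X' ε x ω / G ε) (nhdsWithin 0 (Set.Ioi 0)) (nhds L)}
            ≤ ENNReal.ofReal (2 - a ^ 2 / 2)) ∧
      -- for a > 2 the set of thick points is almost surely empty
      (∀ a : ℝ, 2 < a →
        ∀ᵐ ω ∂P,
          {x : EuclideanSpace ℝ (Fin 2) | x ∈ D ∧
              ∃ L : ℝ, a ≤ L ∧
                Tendsto (fun ε => X' ε x ω / G ε) (nhdsWithin 0 (Set.Ioi 0)) (nhds L)}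
            = ∅) := by
  have hfr : (frontier D).Nonempty := by
    rw [nonempty_frontier_iff]
    refine ⟨hDne, ?_⟩
    rintro rfl
    exact NormedSpace.unbounded_univ ℝ (EuclideanSpace ℝ (Fin 2)) hDbdd
  obtain ⟨R, hR, hDR⟩ : ∃ R : ℕ, 1 ≤ R ∧ ∀ x ∈ D, ‖x‖ ≤ R := by
    obtain ⟨r, hr⟩ := hDbdd.exists_norm_le
    refine ⟨max 1 ⌈r⌉₊, le_max_left _ _, fun x hx => (hr x hx).trans ?_⟩
    refine (Nat.le_ceil r).trans ?_
    exact_mod_cast le_max_right _ _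
  let A : ℕ → Set E2 := fun i => {z ∈ D | 1 / ((i : ℝ) + 1) < Metric.infDist z (frontier D)}
  have hAo : ∀ i, IsOpen (A i) := fun i =>
    hDopen.inter (isOpen_lt continuous_const (Metric.continuous_infDist_pt _))
  have hAD : ∀ i, A i ⊆ D := fun i z hz => hz.1
  have hAR : ∀ i, ∀ x ∈ A i, ‖x‖ ≤ R := fun i x hx => hDR x hx.1
  have hAU : ∀ x ∈ D, ∃ i, x ∈ A i := by
    intro x hx
    have hpos : 0 < Metric.infDist x (frontier D) := by
      rw [← isClosed_frontier.notMem_iff_infDist_pos hfr]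
      intro h
      rw [hDopen.frontier_eq] at h
      exact h.2 hx
    obtain ⟨i, hi⟩ := exists_nat_one_div_lt hpos
    exact ⟨i, hx, hi⟩
  have hAC : ∀ i, ∃ C : ℝ, 0 < C ∧ IncrBd P X (A i) C := by
    intro i
    obtain ⟨C, hC, h⟩ := hA (1 / ((i : ℝ) + 1)) (by positivity)
    exact ⟨C, hC, h⟩
  choose C hC hib using hAC
  obtain ⟨ρ, hρ, hρ1, hρ2, -⟩ := exists_rho 1 le_rfl
  have hcov : ∀ a s : ℝ, 0 < a → 2 - s < a ^ 2 / 2 → ∀ᵐ ω ∂P, ∀ i, _ :=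
    fun a s ha hs => ae_all_iff.2 fun i =>
      thick_cover hgauss (hAo i) (hAD i) (hC i) (hib i) R hR (hAR i) hGvar hGlim a s ha hs
  refine ⟨XX X, ?_, ?_, ?_, ?_⟩
  · intro ε hε x hx
    obtain ⟨i, hi⟩ := hAU x hx
    exact XX_modif hgauss (hAo i) (hAD i) (hC i) (hib i) hρ hρ1 hρ2 hε hi
  · have h : ∀ᵐ ω ∂P, ∀ i, Good (A i) ρ (fun ε x => X ε x ω) := ae_all_iff.2 fun i =>
      good_ae hgauss (hAD i) (hC i) (hib i) R hR (hAR i) hρ hρ1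
    filter_upwards [h] with ω hω
    rintro ⟨ε, x⟩ hp
    obtain ⟨i, hi⟩ := hAU x hp.2
    exact XX_cont X ω (hAo i) hρ hρ1 hρ2 (hω i) hp.1 hi
  · intro a ha ha2
    rcases ha.eq_or_lt with rfl | ha
    · refine Eventually.of_forall fun ω => ?_
      refine (dimH_mono (Set.subset_univ _)).trans ?_
      rw [Real.dimH_univ_eq_finrank]
      simp
    have h : ∀ᵐ ω ∂P, ∀ n : ℕ, ∀ i : ℕ, _ := ae_all_iff.2 fun n : ℕ =>
      hcov a (2 - a ^ 2 / 2 + 1 / ((n : ℝ) + 1)) ha (by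
        have : (0:ℝ) < 1 / ((n : ℝ) + 1) := by positivity
        linarith)
    filter_upwards [h] with ω hω
    have hbase : 0 ≤ 2 - a ^ 2 / 2 := by nlinarith
    have hn : ∀ n : ℕ, dimH {x : EuclideanSpace ℝ (Fin 2) | x ∈ D ∧
              ∃ L : ℝ, a ≤ L ∧
                Tendsto (fun ε => XX X ε x ω / G ε) (nhdsWithin 0 (Set.Ioi 0)) (nhds L)}
            ≤ ENNReal.ofReal (2 - a ^ 2 / 2 + 1 / ((n : ℝ) + 1)) := by
      intro n
      have hsub : {x : EuclideanSpace ℝ (Fin 2) | x ∈ D ∧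
              ∃ L : ℝ, a ≤ L ∧
                Tendsto (fun ε => XX X ε x ω / G ε) (nhdsWithin 0 (Set.Ioi 0)) (nhds L)} ⊆
          ⋃ i : ℕ, {x | x ∈ A i ∧ ∃ L : ℝ, a ≤ L ∧
                Tendsto (fun ε => XX X ε x ω / G ε) (nhdsWithin 0 (Set.Ioi 0)) (nhds L)} := by
        rintro x ⟨hx, hL⟩
        obtain ⟨i, hi⟩ := hAU x hx
        exact Set.mem_iUnion.2 ⟨i, hi, hL⟩
      refine (dimH_mono hsub).trans ?_
      rw [dimH_iUnion]
      refine iSup_le fun i => ?_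
      obtain ⟨N, H, hN, hcard, hmem⟩ := hω n i
      refine dimH_of_cover _ N hN H _ (by positivity) hcard ?_
      rintro x ⟨hx, L, hL, hlim⟩
      exact hmem x hx L hL hlim
    refine ge_of_tendsto' (x := atTop) ?_ hn
    have : Tendsto (fun n : ℕ => 2 - a ^ 2 / 2 + 1 / ((n : ℝ) + 1)) atTop
        (nhds (2 - a ^ 2 / 2 + 0)) := tendsto_one_div_add_atTop_nhds_zero_nat.const_add _
    rw [add_zero] at this
    exact ENNReal.tendsto_ofReal this
  · intro a ha
    filter_upwards [hcov a 0 (by linarith) (by nlinarith)] with ω hω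
    ext x
    simp only [Set.mem_setOf_eq, Set.mem_empty_iff_false, iff_false]
    rintro ⟨hx, L, hL, hlim⟩
    obtain ⟨i, hi⟩ := hAU x hx
    obtain ⟨N, H, hN, hcard, hmem⟩ := hω i
    obtain ⟨l, h1, h2⟩ := (hcard.and (hmem x hi L hL hlim)).exists
    rw [zero_mul, Real.rpow_zero] at h1
    have h3 : (H l).card < 1 := by exact_mod_cast h1
    have h4 : 0 < (H l).card := Finset.card_pos.2 ⟨_, h2⟩
    omega
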